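/- arXiv:1108.0394 — 7 statements merged into one kernel-verified Lean document; each statement's English description precedes it below -/
import Mathlib

section
/- Let M be a finitely generated A-module which admits a connection ∇ : M → Ω¹_{A/k} ⊗_A M. Then M is a projective A-module. (Paper's Lemma 1.4.) -/
open scoped TensorProduct

universe u v

/-- Some nonzero multiple of the identity of a f.g. module over a domain factors through a free
module. -/
lemma aux_nonzero {A : Type u} {M : Type v} [CommRing A] [IsDomain A]
    [AddCommGroup M] [Module A M] [Module.Finite A M] :
    ∃ a : A, a ≠ 0 ∧ ∃ t : Module.Dual A M ⊗[A] M, ∀ m, dualTensorHom A M M t m = a • m := by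
  obtain ⟨s, hs, hli⟩ := exists_set_linearIndependent A M
  have hfin : Module.rank A M < Cardinal.aleph0 := Module.rank_lt_aleph0 A M
  have : Finite s := by rw [← Cardinal.lt_aleph0_iff_finite, hs]; exact hfin
  have := Fintype.ofFinite s
  set N := Submodule.span A (Set.range ((↑) : s → M)) with hN
  have hrN : Module.rank A N = Module.rank A M := by
    rw [hN, rank_span hli, ← hs, Subtype.range_coe]
  have hq : Module.rank A (M ⧸ N) = 0 := by
    have h := HasRankNullity.rank_quotient_add_rank N
    rw [hrN] at h
    have h2 : Module.rank A (M ⧸ N) + Module.rank A M = 0 + Module.rank A M := by rw [h, zero_add]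
    exact Cardinal.eq_of_add_eq_add_right h2 hfin
  rw [rank_eq_zero_iff] at hq
  have htor : Module.IsTorsion A (M ⧸ N) := by
    intro x
    obtain ⟨a, ha, hx⟩ := hq x
    exact ⟨⟨a, mem_nonZeroDivisors_of_ne_zero ha⟩, hx⟩
  obtain ⟨a, ha, ha0⟩ := Submodule.annihilator_top_inter_nonZeroDivisors htor
  refine ⟨a, nonZeroDivisors.ne_zero ha0, ?_⟩
  have hmem : ∀ m : M, a • m ∈ N := by
    intro m
    have := (Submodule.mem_annihilator.1 ha) (N.mkQ m) trivial
    rw [← map_smul] at this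
    exact (Submodule.Quotient.mk_eq_zero N).1 this
  let f : M →ₗ[A] N := LinearMap.codRestrict N (LinearMap.lsmul A M a) hmem
  let b : Module.Basis s A N := Module.Basis.span hli
  refine ⟨∑ i, ((b.coord i).comp f) ⊗ₜ (b i : M), fun m => ?_⟩
  have h := congrArg (N.subtype) (b.sum_repr (f m))
  simp only [map_sum, map_smul, Submodule.subtype_apply] at h
  simp only [map_sum, LinearMap.sum_apply, dualTensorHom_apply, LinearMap.comp_apply,
    Module.Basis.coord_apply]
  rw [h]
  rfl

/-- Covariant derivative stability. -/
lemma aux_stable {k A : Type u} {M : Type v} [Field k] [CommRing A] [Algebra k A]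
    [AddCommGroup M] [Module A M] (δ : Derivation k A A) (D : M →+ M)
    (hD : ∀ (a : A) (m : M), D (a • m) = δ a • m + a • D m) (t : Module.Dual A M ⊗[A] M) :
    ∃ t' : Module.Dual A M ⊗[A] M, ∀ m,
      D (dualTensorHom A M M t m) = dualTensorHom A M M t (D m) + dualTensorHom A M M t' m := by
  induction t with
  | zero => exact ⟨0, by simp⟩
  | add x y hx hy =>
    obtain ⟨x', hx⟩ := hx
    obtain ⟨y', hy⟩ := hy
    refine ⟨x' + y', fun m => ?_⟩
    simp only [map_add, LinearMap.add_apply, hx, hy]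
    abel
  | tmul f v =>
    let g : Module.Dual A M :=
      { toFun := fun m => δ (f m) - f (D m)
        map_add' := by intro x y; simp only [map_add]; ring
        map_smul' := by
          intro a x
          simp only [map_smul, hD, map_add, smul_eq_mul, Derivation.leibniz, RingHom.id_apply]
          ring }
    refine ⟨g ⊗ₜ v + f ⊗ₜ D v, fun m => ?_⟩
    have hg : g m = δ (f m) - f (D m) := rfl
    simp only [map_add, LinearMap.add_apply, dualTensorHom_apply, hD, hg, sub_smul]
    abel

/-- Euler derivation at a closed point. -/
lemma aux_euler {k A : Type u} [Field k] [IsAlgClosed k] [CommRing A] [Algebra k A]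
    [Algebra.FormallySmooth k A] [Algebra.FiniteType k A] (m : Ideal A) [m.IsMaximal] :
    ∃ (r : ℕ) (x : Fin r → A) (δ : Fin r → Derivation k A A), (∀ i, x i ∈ m) ∧
      ∀ a ∈ m, (∑ i, x i * δ i a) - a ∈ m ^ 2 := by
  have : IsNoetherianRing A := Algebra.FiniteType.isNoetherianRing k A
  letI : Field (A ⧸ m) := Ideal.Quotient.field m
  have : Module.Finite k (A ⧸ m) := finite_of_finite_type_of_isJacobsonRing k (A ⧸ m)
  have hbij : Function.Bijective (algebraMap k (A ⧸ m)) :=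
    IsAlgClosed.algebraMap_bijective_of_isIntegral
  let e : k ≃ₐ[k] (A ⧸ m) := AlgEquiv.ofBijective (Algebra.ofId k (A ⧸ m)) hbij
  let c : A →ₐ[k] k := e.symm.toAlgHom.comp (Ideal.Quotient.mkₐ k m)
  have hc : ∀ a : A, a - algebraMap k A (c a) ∈ m := by
    intro a
    rw [← Ideal.Quotient.eq_zero_iff_mem, map_sub, sub_eq_zero]
    have : e (c a) = Ideal.Quotient.mk m a := e.apply_symm_apply _
    rw [← this]
    exact (e.commutes (c a)).trans rfl
  have hc0 : ∀ a ∈ m, c a = 0 := by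
    intro a ha
    have : Ideal.Quotient.mk m a = 0 := Ideal.Quotient.eq_zero_iff_mem.2 ha
    change e.symm (Ideal.Quotient.mk m a) = 0
    rw [this, map_zero]
  let p : A →ₗ[k] m :=
    { toFun := fun a => ⟨a - algebraMap k A (c a), hc a⟩
      map_add' := by intro a b; ext; simp; ring
      map_smul' := by intro a b; ext; simp [Algebra.smul_def]; ring }
  let d : Derivation k A m.Cotangent := Derivation.mk'
    ((m.toCotangent.restrictScalars k).comp p) (by
      intro a b
      simp only [LinearMap.comp_apply, LinearMap.coe_restrictScalars]
      rw [← m.toCotangent.map_smul, ← m.toCotangent.map_smul, ← map_add, Ideal.toCotangent_eq]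
      simp only [p, LinearMap.coe_mk, AddHom.coe_mk, Submodule.coe_add, Submodule.coe_smul,
        smul_eq_mul, map_mul]
      have : a * b - algebraMap k A (c a) * algebraMap k A (c b) -
          (a * (b - algebraMap k A (c b)) + b * (a - algebraMap k A (c a))) =
          - ((a - algebraMap k A (c a)) * (b - algebraMap k A (c b))) := by ring
      rw [this, pow_two]
      exact neg_mem (Ideal.mul_mem_mul (hc a) (hc b)))
  obtain ⟨r, g, hg⟩ := Module.Finite.exists_fin' A m
  obtain ⟨h, hh⟩ := Module.projective_lifting_property (m.toCotangent.comp g)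
    d.liftKaehlerDifferential ((Ideal.toCotangent_surjective m).comp hg)
  refine ⟨r, fun i => (g (Pi.single i 1) : A),
    fun i => ((LinearMap.proj i).comp h).compDer (KaehlerDifferential.D k A),
    fun i => (g _).2, fun a ha => ?_⟩
  have h1 := LinearMap.congr_fun hh (KaehlerDifferential.D k A a)
  rw [Derivation.liftKaehlerDifferential_comp_D] at h1
  have h2 : m.toCotangent (g (h (KaehlerDifferential.D k A a))) = m.toCotangent (p a) := h1
  rw [Ideal.toCotangent_eq] at h2
  have h3 : (p a : A) = a := by
    change a - algebraMap k A (c a) = a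
    rw [hc0 a ha]; simp
  rw [h3] at h2
  convert h2 using 2
  have h4 : ∀ w : Fin r → A, (g w : A) = ∑ i, (g (Pi.single i 1) : A) * w i := by
    intro w
    conv_lhs => rw [pi_eq_sum_univ' w]
    simp only [map_sum, map_smul, AddSubmonoidClass.coe_finsetSum, Submodule.coe_smul,
      smul_eq_mul]
    refine Finset.sum_congr rfl fun i _ => ?_
    rw [mul_comm]
  rw [h4]
  rfl

/-- Differential simplicity. -/
lemma aux_simple {k A : Type u} [Field k] [IsAlgClosed k] [CharZero k] [CommRing A] [IsDomain A]
    [Algebra k A] [Algebra.FormallySmooth k A] [Algebra.FiniteType k A] (J : Ideal A)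
    (hJ : ∀ (δ : Derivation k A A), ∀ a ∈ J, δ a ∈ J) (hJ0 : J ≠ ⊥) : J = ⊤ := by
  have : IsNoetherianRing A := Algebra.FiniteType.isNoetherianRing k A
  by_contra hne
  obtain ⟨m, hm, hJm⟩ := Ideal.exists_le_maximal J hne
  obtain ⟨r, x, δ, hx, hE⟩ := aux_euler (k := k) m
  let E : Derivation k A A := ∑ i, x i • δ i
  have hEa : ∀ a, E a = ∑ i, x i * δ i a := by
    intro a
    let ev : Derivation k A A →+ A :=
      { toFun := fun d => d a, map_zero' := rfl, map_add' := fun _ _ => rfl }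
    exact map_sum ev _ _
  have hpow : ∀ n : ℕ, ∀ a ∈ m ^ n, E a - (n : A) * a ∈ m ^ (n + 1) := by
    intro n
    induction n with
    | zero =>
      intro a _
      simp only [Nat.cast_zero, zero_mul, sub_zero, zero_add, pow_one, hEa]
      exact Ideal.sum_mem _ fun i _ => Ideal.mul_mem_right _ _ (hx i)
    | succ n ih =>
      intro a ha
      rw [pow_succ] at ha
      induction ha using Submodule.mul_induction_on' with
      | mem_mul_mem u hu v hv =>
        have h1 := Ideal.mul_mem_mul (ih u hu) hv
        have h2 := Ideal.mul_mem_mul hu (hE v hv)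
        rw [← hEa] at h2
        rw [← pow_succ] at h1
        rw [← pow_add] at h2
        have : E (u * v) - ((n + 1 : ℕ) : A) * (u * v) =
            (E u - n * u) * v + u * (E v - v) := by
          rw [Derivation.leibniz]; simp only [smul_eq_mul]; push_cast; ring
        rw [this]
        exact add_mem h1 h2
      | add u _ v _ hu hv =>
        have := add_mem hu hv
        rw [map_add]
        convert this using 1
        ring
  have hind : ∀ n : ℕ, J ≤ m ^ (n + 1) := by
    intro n
    induction n with
    | zero => simpa using hJm
    | succ n ih =>
      intro a ha
      have h1 := hpow (n + 1) a (ih ha)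
      have h2 : E a ∈ m ^ (n + 1 + 1) := by
        rw [hEa]
        refine Ideal.sum_mem _ fun i _ => ?_
        rw [pow_succ', ]
        exact Ideal.mul_mem_mul (hx i) (ih (hJ _ _ ha))
      have h3 := sub_mem h2 h1
      rw [sub_sub_cancel] at h3
      have hn : ((n + 1 : ℕ) : k) ≠ 0 := Nat.cast_ne_zero.2 (Nat.succ_ne_zero n)
      have h4 := Ideal.mul_mem_left _ (algebraMap k A ((n + 1 : ℕ) : k)⁻¹) h3
      rw [← mul_assoc, ← map_natCast (algebraMap k A), ← map_mul, inv_mul_cancel₀ hn, map_one,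
        one_mul] at h4
      exact h4
  apply hJ0
  rw [eq_bot_iff, ← Ideal.iInf_pow_eq_bot_of_isDomain m hm.ne_top]
  refine le_iInf fun n => ?_
  exact (hind n).trans (Ideal.pow_le_pow_right (Nat.le_succ n))

/-- Paper's Lemma 1.4: a finitely generated module over the coordinate ring of a
smooth affine curve which admits a connection is projective. -/
theorem stmt_0 {k A : Type u} {M : Type v} [Field k] [IsAlgClosed k] [CharZero k]
    [CommRing A] [IsDomain A] [Algebra k A]
    [Algebra.FormallySmooth k A] [Algebra.FinitePresentation k A]
    (hdim : ringKrullDim A = 1)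
    [AddCommGroup M] [Module A M] [Module.Finite A M]
    (nabla : M →+ TensorProduct A (KaehlerDifferential k A) M)
    (leibniz : ∀ (a : A) (m : M),
      nabla (a • m) = (KaehlerDifferential.D k A a) ⊗ₜ[A] m + a • nabla m) :
    Module.Projective A M := by
  let J : Ideal A :=
    Submodule.comap (LinearMap.toSpanSingleton A (Module.End A M) 1)
      (LinearMap.range (dualTensorHom A M M))
  have hJmem : ∀ a : A, a ∈ J ↔
      ∃ t : Module.Dual A M ⊗[A] M, ∀ m, dualTensorHom A M M t m = a • m := by
    intro a
    simp only [J, Submodule.mem_comap, LinearMap.mem_range, LinearMap.toSpanSingleton_apply]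
    exact exists_congr fun t => LinearMap.ext_iff
  have hJ : J = ⊤ := by
    apply aux_simple (k := k) J
    · intro δ a ha
      rw [hJmem] at ha ⊢
      obtain ⟨t, ht⟩ := ha
      let L : (KaehlerDifferential k A) ⊗[A] M →ₗ[A] M :=
        (TensorProduct.lid A M).toLinearMap.comp
          (LinearMap.rTensor M δ.liftKaehlerDifferential)
      let D : M →+ M := L.toAddMonoidHom.comp nabla
      have hD : ∀ (a : A) (m : M), D (a • m) = δ a • m + a • D m := by
        intro a m
        change L (nabla (a • m)) = δ a • m + a • L (nabla m)
        rw [leibniz, map_add, map_smul]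
        simp [L]
      obtain ⟨t', ht'⟩ := aux_stable δ D hD t
      refine ⟨t', fun m => ?_⟩
      have := ht' m
      rw [ht, ht, hD, add_comm] at this
      exact (add_left_cancel this).symm
    · obtain ⟨a, ha, h⟩ := aux_nonzero (A := A) (M := M)
      intro h0
      have := (hJmem a).2 h
      rw [h0] at this
      exact ha this
  have h1 : (1 : A) ∈ J := hJ ▸ Submodule.mem_top
  apply Module.Projective.of_one_mem_range_dualTensorHom
  obtain ⟨t, ht⟩ := (hJmem 1).1 h1
  exact ⟨t, LinearMap.ext fun m => by rw [ht, one_smul]; rfl⟩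
end

section
/- Let M be a finitely generated A-module equipped with a connection ∇ : M → Ω¹_{A/k} ⊗_A M. Suppose x ∈ M and a ∈ A with a ≠ 0 satisfy a·∇(x) = d a ⊗ x in Ω¹_{A/k} ⊗_A M (i.e., the rational section x/a of M is horizontal). Then there exists m ∈ M with x = a·m; in other words, every rational solution of ∇f = 0 lies in M itself. (Paper's Lemma 1.5.) -/
open scoped TensorProduct

universe u v

namespace ConnAux

/-- Elements of a minimal prime are nilpotent modulo the ideal, up to denominators. -/
lemma exists_mul_pow_mem {A : Type*} [CommRing A] {I p : Ideal A} (hp : p ∈ I.minimalPrimes)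
    {b : A} (hb : b ∈ p) : ∃ c ∉ p, ∃ n : ℕ, c * b ^ n ∈ I := by
  have : p.IsPrime := hp.1.1
  by_contra! h
  obtain ⟨q, hq, hIq, hdis⟩ := Ideal.exists_le_prime_disjoint I (p.primeCompl ⊔ Submonoid.powers b)
    (by
      rw [Set.disjoint_left]
      intro y hy hy'
      obtain ⟨c, hc, z, ⟨n, rfl⟩, rfl⟩ := Submonoid.mem_sup.1 hy'
      exact h c hc n hy)
  rw [Set.disjoint_left] at hdis
  have hqp : q ≤ p := by
    intro y hy
    by_contra hyp
    exact hdis hy ((le_sup_left : p.primeCompl ≤ _) hyp)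
  have hpq := hp.2 ⟨hq, hIq⟩ hqp
  exact hdis (hpq hb) ((le_sup_right : Submonoid.powers b ≤ _) (Submonoid.mem_powers b))

lemma der_mem_aux {k A : Type*} [Field k] [CharZero k] [CommRing A] [Algebra k A]
    {I p : Ideal A} (hp : p.IsPrime) (hIp : I ≤ p) (δ : Derivation k A A)
    (hI : ∀ b ∈ I, δ b ∈ I) (b : A) (n : ℕ) :
    ∀ (m : ℕ) (c : A), c ∉ p → c * b ^ n * (δ b) ^ (m + 1) ∈ I → δ b ∈ p := by
  induction n with
  | zero =>
    intro m c hc h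
    have h := hIp h
    rw [pow_zero, mul_one] at h
    exact hp.mem_of_pow_mem _ ((hp.mem_or_mem h).resolve_left hc)
  | succ n ih =>
    intro m c hc h
    have hu : ((n + 1 : ℕ) : A) ∉ p := by
      intro hmem
      apply hp.ne_top
      refine Ideal.eq_top_of_isUnit_mem _ hmem ?_
      have : ((n + 1 : ℕ) : A) = algebraMap k A ((n + 1 : ℕ) : k) := by simp
      rw [this]
      exact (IsUnit.mk0 _ (Nat.cast_ne_zero.2 n.succ_ne_zero)).map _
    refine ih (m + 2) (((n + 1 : ℕ) : A) * c * c) ?_ ?_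
    · intro hmem
      rcases hp.mem_or_mem hmem with hmem | hmem
      · rcases hp.mem_or_mem hmem with hmem | hmem
        · exact hu hmem
        · exact hc hmem
      · exact hc hmem
    · have h1 := I.mul_mem_left (c * δ b) (hI _ h)
      have h2 := I.mul_mem_left (δ c * δ b) h
      have h3 := I.mul_mem_left (((m + 1 : ℕ) : A) * c * δ (δ b)) h
      have h4 := I.sub_mem (I.sub_mem h1 h2) h3
      convert h4 using 1
      simp only [Derivation.leibniz, Derivation.leibniz_pow, smul_eq_mul, nsmul_eq_mul,
        Nat.add_sub_cancel]
      push_cast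
      ring

/-- A smooth curve in characteristic zero is differentially simple. -/
lemma diff_simple {k A : Type u} [Field k] [IsAlgClosed k] [CharZero k]
    [CommRing A] [IsDomain A] [Algebra k A]
    [Algebra.FormallySmooth k A] [Algebra.FinitePresentation k A]
    (hdim : ringKrullDim A = 1) (I : Ideal A) (hI0 : I ≠ ⊥)
    (hI : ∀ δ : Derivation k A A, ∀ b ∈ I, δ b ∈ I) : I = ⊤ := by
  by_contra hne
  obtain ⟨P, hP, hIP⟩ := Ideal.exists_le_maximal I hne
  obtain ⟨p, hp, -⟩ := Ideal.exists_minimalPrimes_le (J := P) hIP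
  have hpp : p.IsPrime := hp.1.1
  have hIp : I ≤ p := hp.1.2
  have hp0 : p ≠ ⊥ := fun h => hI0 (le_bot_iff.1 (h ▸ hIp))
  have hK : Ring.KrullDimLE 1 A := (Order.krullDimLE_iff 1 _).2 (by
    rw [← ringKrullDim, hdim]; rfl)
  have hpm : p.IsMaximal := Ring.krullDimLE_one_iff_of_noZeroDivisors.1 hK p hp0 hpp
  -- `p` is stable under derivations
  have hst : ∀ δ : Derivation k A A, ∀ b ∈ p, δ b ∈ p := by
    intro δ b hb
    obtain ⟨c, hc, n, h⟩ := exists_mul_pow_mem hp hb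
    exact der_mem_aux hpp hIp δ (hI δ) b n 0 c hc (I.mul_mem_right _ h)
  -- hence every derivation maps into `p`
  have hall : ∀ δ : Derivation k A A, ∀ b, δ b ∈ p := by
    intro δ b
    letI := Ideal.Quotient.field p
    have : Module.Finite k (A ⧸ p) := finite_of_finite_type_of_isJacobsonRing k (A ⧸ p)
    obtain ⟨c, hc⟩ := (IsAlgClosed.algebraMap_bijective_of_isIntegral (k := k) (K := A ⧸ p)).2
      (Ideal.Quotient.mk p b)
    have hm : b - algebraMap k A c ∈ p := by
      rw [← Ideal.Quotient.eq, ← hc]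
      rfl
    have := hst δ _ hm
    simpa using this
  have hfun : ∀ (φ : KaehlerDifferential k A →ₗ[A] A) (w), φ w ∈ p := by
    intro φ w
    have hw : w ∈ Submodule.span A (Set.range (KaehlerDifferential.D k A)) := by
      rw [KaehlerDifferential.span_range_derivation]; trivial
    induction hw using Submodule.span_induction with
    | mem x h =>
      obtain ⟨b, rfl⟩ := h
      exact hall (φ.compDer (KaehlerDifferential.D k A)) b
    | zero => simp
    | add x y _ _ hx hy => rw [map_add]; exact p.add_mem hx hy
    | smul a x _ hx => rw [map_smul]; exact p.mul_mem_left _ hx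
  obtain ⟨s, hs⟩ := (Algebra.FormallySmooth.projective_kaehlerDifferential (R := k) (A := A)).out
  have hle : (⊤ : Submodule A (KaehlerDifferential k A)) ≤ p • ⊤ := by
    intro w _
    rw [← hs w, Finsupp.linearCombination_apply]
    refine Submodule.sum_mem _ fun i _ => Submodule.smul_mem_smul ?_ trivial
    exact hfun (Finsupp.lapply i ∘ₗ s) w
  obtain ⟨r, hr, hr0⟩ := Submodule.exists_sub_one_mem_and_smul_eq_zero_of_fg_of_le_smul p ⊤
    (Module.Finite.fg_top) hle
  have hrne : r ≠ 0 := by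
    rintro rfl
    exact hpp.ne_top ((Ideal.eq_top_iff_one _).2 (by simpa using p.neg_mem hr))
  have hsub : Subsingleton (KaehlerDifferential k A) := by
    refine subsingleton_of_forall_eq 0 fun w => ?_
    have h1 : s w = 0 := by
      ext i
      have : r * s w i = 0 := by
        have := congrArg (fun z => s z i) (hr0 w trivial)
        simpa using this
      simpa [hrne] using this
    rw [← hs w, h1, map_zero]
  have : Algebra.FormallyUnramified k A := ⟨hsub⟩
  have : Module.Finite k A := Algebra.FormallyUnramified.finite_of_free k A
  have hf : IsField A := isField_of_isIntegral_of_isField' (Field.toIsField k)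
  rw [ringKrullDim_eq_zero_of_isField hf] at hdim
  exact zero_ne_one hdim

end ConnAux

/-- Paper's Lemma 1.5: for a finitely generated module with connection over the
coordinate ring of a smooth affine curve, every rational solution of `∇ f = 0`
lies in the module itself. -/
theorem stmt_1 {k A : Type u} {M : Type v} [Field k] [IsAlgClosed k] [CharZero k]
    [CommRing A] [IsDomain A] [Algebra k A]
    [Algebra.FormallySmooth k A] [Algebra.FinitePresentation k A]
    (hdim : ringKrullDim A = 1)
    [AddCommGroup M] [Module A M] [Module.Finite A M]
    (nabla : M →+ TensorProduct A (KaehlerDifferential k A) M)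
    (leibniz : ∀ (a : A) (m : M),
      nabla (a • m) = (KaehlerDifferential.D k A a) ⊗ₜ[A] m + a • nabla m)
    (x : M) (a : A) (ha : a ≠ 0)
    (hx : a • nabla x = (KaehlerDifferential.D k A a) ⊗ₜ[A] x) :
    ∃ m : M, x = a • m := by
  have hN : IsNoetherianRing A := Algebra.FiniteType.isNoetherianRing k A
  -- contraction with derivations
  let C : Derivation k A A → (TensorProduct A (KaehlerDifferential k A) M →ₗ[A] M) := fun δ =>
    TensorProduct.lift ((LinearMap.lsmul A M).comp δ.liftKaehlerDifferential)
  have hC : ∀ δ (b : A) (m : M), C δ (KaehlerDifferential.D k A b ⊗ₜ[A] m) = δ b • m := by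
    intro δ b m
    simp [C]
  let E : Derivation k A A → M → M := fun δ m => C δ (nabla m)
  have hE : ∀ δ (b : A) (m : M), E δ (b • m) = δ b • m + b • E δ m := by
    intro δ b m
    simp only [E, leibniz, map_add, hC, map_smul]
  have hE0 : ∀ δ, E δ 0 = 0 := by intro δ; simp [E]
  have hxE : ∀ δ, a • E δ x = δ a • x := by
    intro δ
    rw [← hC, ← hx, map_smul]
  -- the torsion submodule vanishes
  let T := Submodule.torsion A M
  have hT : ∀ δ, ∀ m ∈ T, E δ m ∈ T := by
    intro δ m hm
    obtain ⟨⟨b, hb⟩, hbm⟩ := (Submodule.mem_torsion_iff m).1 hm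
    have hbm : b • m = 0 := hbm
    refine (Submodule.mem_torsion_iff _).2 ⟨⟨b * b, mul_mem hb hb⟩, ?_⟩
    change (b * b) • E δ m = 0
    have h1 := hE δ b m
    rw [hbm, hE0] at h1
    have h2 := congrArg (b • ·) h1
    simp only [smul_zero, smul_add] at h2
    rw [smul_comm, hbm, smul_zero, zero_add] at h2
    rw [mul_smul, ← h2]
  have hTtop : T.annihilator = ⊤ := by
    refine ConnAux.diff_simple (k := k) hdim _ ?_ ?_
    · obtain ⟨b, hb, hb0⟩ := Submodule.annihilator_top_inter_nonZeroDivisors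
        (Submodule.torsion_isTorsion (R := A) (M := M))
      intro h
      have : b ∈ T.annihilator := by
        rw [Submodule.mem_annihilator]
        intro m hm
        have := Submodule.mem_annihilator.1 hb ⟨m, hm⟩ trivial
        exact congrArg Subtype.val this
      rw [h] at this
      exact nonZeroDivisors.ne_zero hb0 this
    · intro δ b hb
      rw [Submodule.mem_annihilator] at hb ⊢
      intro m hm
      have h1 := hE δ b m
      rw [hb m hm, hE0, hb _ (hT δ m hm), add_zero] at h1
      exact h1.symm
  have htf : ∀ m : M, a • m = 0 → m = 0 := by
    intro m hm
    have hmT : m ∈ T := (Submodule.mem_torsion_iff m).2 ⟨⟨a, mem_nonZeroDivisors_of_ne_zero ha⟩, hm⟩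
    have h1 : (1 : A) ∈ T.annihilator := hTtop ▸ Submodule.mem_top
    simpa using Submodule.mem_annihilator.1 h1 m hmT
  -- the ideal of denominators
  let I : Ideal A :=
    Submodule.comap (LinearMap.toSpanSingleton A M x) (LinearMap.range (LinearMap.lsmul A M a))
  have hImem : ∀ b, b ∈ I ↔ ∃ y : M, a • y = b • x := by
    intro b
    simp [I]
  have hItop : I = ⊤ := by
    refine ConnAux.diff_simple (k := k) hdim I ?_ ?_
    · intro h
      have : a ∈ I := (hImem a).2 ⟨x, rfl⟩
      rw [h] at this
      exact ha this
    · intro δ b hb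
      obtain ⟨y, hy⟩ := (hImem b).1 hb
      refine (hImem _).2 ⟨E δ y, ?_⟩
      have h1 := congrArg (E δ) hy
      rw [hE, hE] at h1
      have h2 := congrArg (a • ·) h1
      simp only [smul_add] at h2
      rw [smul_comm a (δ a) y, hy, smul_comm a b (E δ x), hxE, smul_comm (δ a) b x,
        add_comm, add_left_inj] at h2
      rw [← sub_eq_zero]
      apply htf
      rw [smul_sub, h2, sub_self]
  obtain ⟨y, hy⟩ := (hImem 1).1 (hItop ▸ Submodule.mem_top)
  exact ⟨y, by rw [hy, one_smul]⟩
end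

section
/- Let F₀ be a (possibly unbounded) ℤ-indexed cochain complex of A-modules all of whose terms are projective, and let F₁ be an acyclic ℤ-indexed cochain complex of A-modules. Then for every n ∈ ℤ, every morphism of cochain complexes from F₀ to the shifted complex F₁⟦n⟧ is chain homotopic to zero; i.e., the hom-complex hom(F₀, F₁) is acyclic, so complexes of projective A-modules are K-projective. (Paper's Lemma 1.6.) -/
open CategoryTheory

universe u v

section commalg
open TensorProduct nonZeroDivisors

theorem isIntegrallyClosed_of_etale (R S : Type*) [CommRing R] [IsDomain R] [IsIntegrallyClosed R]
    [CommRing S] [IsDomain S] [Algebra R S] [Algebra.Etale R S] : IsIntegrallyClosed S := by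
  let K := FractionRing R
  let T := S ⊗[R] K
  have hflat : Module.Flat R S := inferInstance
  have hinj : Function.Injective (algebraMap R S) := FaithfulSMul.algebraMap_injective R S
  have hM : Algebra.algebraMapSubmonoid S R⁰ ≤ S⁰ :=
    map_le_nonZeroDivisors_of_injective _ hinj le_rfl
  have hloc : IsLocalization (Algebra.algebraMapSubmonoid S R⁰) T := inferInstance
  have hdom : IsDomain T := IsLocalization.isDomain_of_le_nonZeroDivisors T hM
  have e : T ≃ₐ[R] K ⊗[R] S := Algebra.TensorProduct.comm R S K
  have hdom' : IsDomain (K ⊗[R] S) := e.symm.toMulEquiv.isDomain T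
  have hfin : Module.Finite K (K ⊗[R] S) := Algebra.FormallyUnramified.finite_of_free K _
  have hfield' : IsField (K ⊗[R] S) :=
    isField_of_isIntegral_of_isField' (Field.toIsField K)
  have hfield : IsField T := e.toMulEquiv.isField hfield'
  have hinjT : Function.Injective (algebraMap S T) := IsLocalization.injective T hM
  have hfrac : IsFractionRing S T := by
    refine IsLocalization.of_le _ S⁰ hM fun r hr ↦ ?_
    have h0 : algebraMap S T r ≠ 0 := by
      rw [Ne, map_eq_zero_iff _ hinjT]
      exact nonZeroDivisors.ne_zero hr
    obtain ⟨b, hb⟩ := hfield.mul_inv_cancel h0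
    exact IsUnit.of_mul_eq_one b hb
  refine (isIntegrallyClosed_iff T).mpr fun {x} hx ↦ ?_
  obtain ⟨y, hy⟩ := (TensorProduct.toIntegralClosure_bijective_of_smooth
    (R := R) (S := S) (B := K)).2 ⟨x, hx⟩
  replace hy := congrArg Subtype.val hy
  change _ = x at hy
  rw [← hy]
  clear hy
  induction y with
  | zero => exact ⟨0, by simp⟩
  | add a b ha hb =>
    obtain ⟨a', ha⟩ := ha
    obtain ⟨b', hb⟩ := hb
    exact ⟨a' + b', by rw [map_add, ha, hb, map_add]; rfl⟩
  | tmul s c =>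
    obtain ⟨r, hr⟩ := (isIntegrallyClosed_iff K).mp ‹_› c.2
    refine ⟨r • s, ?_⟩
    change (r • s) ⊗ₜ[R] (1 : K) = s ⊗ₜ[R] (c : K)
    rw [← hr, TensorProduct.smul_tmul, Algebra.smul_def, mul_one]

theorem isIntegrallyClosed_of_smooth (k A : Type*) [Field k] [CommRing A] [IsDomain A]
    [Algebra k A] [Algebra.Smooth k A] : IsIntegrallyClosed A := by
  refine IsIntegrallyClosed.of_localization_maximal fun p _ _ ↦ ?_
  obtain ⟨f, hfm, n, _, _, _⟩ :=
      Algebra.IsSmoothAt.exists_isStandardEtale_mvPolynomial (R := k) (p := p)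
  have hf0 : f ≠ 0 := fun h ↦ hfm (h ▸ zero_mem p)
  have hle : Submonoid.powers f ≤ A⁰ := powers_le_nonZeroDivisors_of_noZeroDivisors hf0
  have : IsDomain (Localization.Away f) := IsLocalization.isDomain_localization hle
  have : IsIntegrallyClosed (Localization.Away f) :=
    isIntegrallyClosed_of_etale (MvPolynomial (Fin n) k) _
  have hle' : Submonoid.powers f ≤ p.primeCompl := by
    rw [Submonoid.powers_le]; exact hfm
  let := IsLocalization.localizationAlgebraOfSubmonoidLe (Localization.Away f)
    (Localization.AtPrime p) _ _ hle'
  have := IsLocalization.localization_isScalarTower_of_submonoid_le (Localization.Away f)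
    (Localization.AtPrime p) _ _ hle'
  have := IsLocalization.isLocalization_of_submonoid_le (Localization.Away f)
    (Localization.AtPrime p) _ _ hle'
  refine isIntegrallyClosed_of_isLocalization (R := Localization.Away f) (Localization.AtPrime p)
    (p.primeCompl.map (algebraMap A (Localization.Away f))) ?_
  exact map_le_nonZeroDivisors_of_injective _ (IsLocalization.injective _ hle)
    p.primeCompl_le_nonZeroDivisors

theorem isDedekindDomain_of_smooth_curve (k A : Type*) [Field k] [CommRing A] [IsDomain A]
    [Algebra k A] [Algebra.Smooth k A] (hdim : ringKrullDim A = 1) : IsDedekindDomain A := by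
  have := isIntegrallyClosed_of_smooth k A
  have : IsNoetherianRing A := Algebra.FiniteType.isNoetherianRing k A
  have : Ring.KrullDimLE 1 A := by
    rw [Ring.krullDimLE_iff, hdim]; rfl
  have : Ring.DimensionLEOne A := ⟨fun {p} h hp ↦ hp.isMaximal_of_ne_bot h⟩
  exact { }

theorem projective_ideal {A : Type*} [CommRing A] [IsDedekindDomain A] (I : Ideal A) :
    Module.Projective A I :=
  have : Module.FinitePresentation A I := Module.finitePresentation_of_finite A I
  Module.Flat.projective_of_finitePresentation

/-- Quotients of injectives over a Dedekind domain are injective. -/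
theorem injective_of_surjective {A : Type u} [CommRing A] [IsDedekindDomain A] [Small.{v} A]
    {E E' : Type v} [AddCommGroup E] [Module A E] [AddCommGroup E'] [Module A E']
    [Module.Injective A E] (q : E →ₗ[A] E') (hq : Function.Surjective q) :
    Module.Injective A E' := by
  refine Module.Baer.injective fun I g ↦ ?_
  have := projective_ideal I
  obtain ⟨g₁, hg₁⟩ := Module.projective_lifting_property q g hq
  obtain ⟨g₂, hg₂⟩ := Module.Baer.of_injective ‹_› I g₁
  exact ⟨q ∘ₗ g₂, fun x hx ↦ by simp [hg₂ x hx, ← hg₁]⟩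

theorem lifting_of_injective {A : Type u} [CommRing A] [IsDedekindDomain A] [Small.{v} A]
    {B P M N E : Type v} [AddCommGroup B] [Module A B] [AddCommGroup P] [Module A P]
    [AddCommGroup M] [Module A M] [AddCommGroup N] [Module A N] [AddCommGroup E] [Module A E]
    [Module.Projective A P] [Module.Injective A E]
    (i : B →ₗ[A] P) (hi : Function.Injective i) (j : M →ₗ[A] E) (hj : Function.Injective j)
    (e : M →ₗ[A] N) (he : Function.Surjective e) (f : B →ₗ[A] N) :
    ∃ h : B →ₗ[A] M, e ∘ₗ h = f := by
  let Q : Submodule A E := (LinearMap.ker e).map j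
  have hQ : LinearMap.ker e ≤ Q.comap j := Submodule.le_comap_map _ _
  let l : N →ₗ[A] E ⧸ Q :=
    (LinearMap.ker e).mapQ Q j hQ ∘ₗ (e.quotKerEquivOfSurjective he).symm.toLinearMap
  have hl : ∀ m, l (e m) = Q.mkQ (j m) := fun m ↦ by
    have : (e.quotKerEquivOfSurjective he).symm (e m) = Submodule.Quotient.mk m := by
      rw [LinearEquiv.symm_apply_eq]; rfl
    simp only [l, LinearMap.comp_apply, LinearEquiv.coe_coe, this]
    rfl
  have hE' : Module.Injective A (E ⧸ Q) := injective_of_surjective Q.mkQ Q.mkQ_surjective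
  obtain ⟨g, hg⟩ := hE'.out i hi (l ∘ₗ f)
  obtain ⟨g', hg'⟩ := Module.projective_lifting_property Q.mkQ g Q.mkQ_surjective
  have key : ∀ b, ∃ m, j m = g' (i b) ∧ e m = f b := fun b ↦ by
    obtain ⟨m, hm⟩ := he (f b)
    have h1 : Q.mkQ (g' (i b)) = Q.mkQ (j m) := by
      rw [← LinearMap.comp_apply, hg', hg, LinearMap.comp_apply, ← hm, hl]
    have h2 : g' (i b) - j m ∈ Q := (Submodule.Quotient.eq Q).mp h1
    obtain ⟨m', hm', h3⟩ := h2
    exact ⟨m + m', by rw [map_add, h3]; abel, by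
      rw [map_add, hm, LinearMap.mem_ker.mp hm', add_zero]⟩
  choose h hh using key
  refine ⟨{ toFun := h, map_add' := fun x y ↦ hj ?_, map_smul' := fun a x ↦ hj ?_ }, ?_⟩
  · simp [(hh _).1]
  · simp [(hh _).1]
  · ext b
    exact (hh b).2

theorem projective_of_mono {A : Type u} [CommRing A] [IsDedekindDomain A] [Small.{v} A]
    {B P : ModuleCat.{v} A} (i : B ⟶ P) [Mono i] [Projective P] : Projective B := by
  refine ⟨fun {M N} f e _ ↦ ?_⟩
  let E : ModuleCat.{v} A := Injective.under M
  let j : M ⟶ E := Injective.ι M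
  have hE : Module.Injective A E :=
    Module.injective_module_of_injective_object A E
      (inj := (inferInstance : Injective (Injective.under M)))
  have hmono : Mono j := (inferInstance : Mono (Injective.ι M))
  obtain ⟨h, hh⟩ := lifting_of_injective i.hom ((ModuleCat.mono_iff_injective _).mp inferInstance)
    j.hom ((ModuleCat.mono_iff_injective _).mp hmono)
    e.hom ((ModuleCat.epi_iff_surjective _).mp inferInstance) f.hom
  exact ⟨ModuleCat.ofHom h, ModuleCat.hom_ext hh⟩

end commalg

section htpy
open Limits
variable {C : Type*} [Category* C] [Abelian C]

/-- In an abelian category in which subobjects of projectives are projective, every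
complex of projectives is K-projective. -/
theorem nonempty_homotopy_zero_of_hereditary
    (hC : ∀ {X P : C} (i : X ⟶ P) [Mono i] [Projective P], Projective X)
    (K L : CochainComplex C ℤ) (hK : ∀ n, Projective (K.X n)) (hL : ∀ n, L.ExactAt n)
    (f : K ⟶ L) : Nonempty (Homotopy f 0) := by
  have hZ : ∀ n, Projective (K.cycles n) := fun n ↦ hC (K.iCycles n)
  have hB : ∀ i j, Projective (Abelian.image (K.d i j)) := fun i j ↦ hC (Abelian.image.ι _)
  -- lifting through the exactness of `L`
  have lift : ∀ (i j : ℤ) (_ : (ComplexShape.up ℤ).Rel j i) (P : C) [Projective P]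
      (φ : P ⟶ L.X i) (_ : φ ≫ L.d i (i + 1) = 0), ∃ ψ : P ⟶ L.X j, ψ ≫ L.d j i = φ := by
    intro i j hij P _ φ hφ
    have hex : (L.sc' j i (i + 1)).Exact :=
      (L.exactAt_iff' j i (i + 1) ((ComplexShape.up ℤ).prev_eq' hij) (by simp)).mp (hL i)
    exact ⟨hex.liftFromProjective φ hφ, hex.liftFromProjective_comp φ hφ⟩
  -- splittings
  let π : ∀ n, K.X n ⟶ Abelian.image (K.d n (n + 1)) := fun n ↦
    Abelian.factorThruImage _
  have hπ : ∀ n, π n ≫ Abelian.image.ι _ = K.d n (n + 1) := fun n ↦ Abelian.image.fac _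
  let σ : ∀ n, Abelian.image (K.d n (n + 1)) ⟶ K.X n := fun n ↦
    Projective.factorThru (𝟙 _) (π n)
  have hσ : ∀ n, σ n ≫ π n = 𝟙 _ := fun n ↦ Projective.factorThru_comp _ _
  have hr0 : ∀ n, (𝟙 _ - π n ≫ σ n) ≫ K.d n (n + 1) = 0 := fun n ↦ by
    have h : (𝟙 _ - π n ≫ σ n) ≫ π n = 0 := by
      rw [Preadditive.sub_comp, Category.assoc, hσ n]
      simp
    have h' := congrArg (fun φ ↦ φ ≫ Abelian.image.ι (K.d n (n + 1))) h
    simpa only [Category.assoc, hπ n, zero_comp] using h'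
  let r : ∀ n, K.X n ⟶ K.cycles n := fun n ↦ K.liftCycles (𝟙 _ - π n ≫ σ n) (n + 1) (by simp) (hr0 n)
  have hr : ∀ n, r n ≫ K.iCycles n = 𝟙 _ - π n ≫ σ n := fun n ↦ by simp [r]
  have hιr : ∀ n, K.iCycles n ≫ r n = 𝟙 _ := fun n ↦ by
    rw [← cancel_mono (K.iCycles n), Category.assoc, hr n, Category.id_comp, Preadditive.comp_sub,
      Category.comp_id, sub_eq_self, ← Category.assoc]
    have : K.iCycles n ≫ π n = 0 := by
      rw [← cancel_mono (Abelian.image.ι (K.d n (n + 1))), Category.assoc, hπ n]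
      simp
    rw [this, zero_comp]
  -- first step: kill the restriction to cycles
  have hs : ∀ (i j : ℤ) (_ : (ComplexShape.up ℤ).Rel j i), ∃ s : K.cycles i ⟶ L.X j,
      s ≫ L.d j i = K.iCycles i ≫ f.f i := fun i j hij ↦
    lift i j hij _ _ (by rw [Category.assoc, f.comm, ← Category.assoc]; simp)
  choose s hs using hs
  let h₀ : ∀ i j, (ComplexShape.up ℤ).Rel j i → (K.X i ⟶ L.X j) := fun i j hij ↦ r i ≫ s i j hij
  let f' : K ⟶ L := f - Homotopy.nullHomotopicMap' h₀
  have hf'Z : ∀ n, K.iCycles n ≫ f'.f n = 0 := fun n ↦ by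
    have h1 : (ComplexShape.up ℤ).Rel (n - 1) n := by simp
    have h2 : (ComplexShape.up ℤ).Rel n (n + 1) := by simp
    simp only [f', HomologicalComplex.sub_f_apply, Homotopy.nullHomotopicMap'_f h1 h2, h₀,
      Preadditive.comp_sub, Preadditive.comp_add, Category.assoc, hs]
    rw [reassoc_of% (hιr n)]
    simp
  have hf'd : ∀ n, f'.f n ≫ L.d n (n + 1) = 0 := fun n ↦ by
    rw [f'.comm, ← K.liftCycles_i (K.d n (n + 1)) (n + 1 + 1) (by simp) (by simp),
      Category.assoc, hf'Z, comp_zero]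
  have hf'π : ∀ n, π n ≫ σ n ≫ f'.f n = f'.f n := fun n ↦ by
    have : (r n ≫ K.iCycles n) ≫ f'.f n = 0 := by rw [Category.assoc, hf'Z, comp_zero]
    rw [hr n, Preadditive.sub_comp, Category.id_comp, sub_eq_zero, Category.assoc] at this
    exact this.symm
  have ht : ∀ (i j : ℤ) (_ : (ComplexShape.up ℤ).Rel j i),
      ∃ t : Abelian.image (K.d i (i + 1)) ⟶ L.X j, t ≫ L.d j i = σ i ≫ f'.f i := fun i j hij ↦
    lift i j hij _ _ (by rw [Category.assoc, hf'd, comp_zero])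
  choose t ht using ht
  let h₁ : ∀ i j, (ComplexShape.up ℤ).Rel j i → (K.X i ⟶ L.X j) := fun i j hij ↦ π i ≫ t i j hij
  have hdπ : ∀ i j, K.d i j ≫ π j = 0 := fun i j ↦ by
    rw [← cancel_mono (Abelian.image.ι (K.d j (j + 1))), Category.assoc, hπ j]
    simp
  have hf' : f' = Homotopy.nullHomotopicMap' h₁ := by
    ext n
    have h1 : (ComplexShape.up ℤ).Rel (n - 1) n := by simp
    have h2 : (ComplexShape.up ℤ).Rel n (n + 1) := by simp
    rw [Homotopy.nullHomotopicMap'_f h1 h2]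
    simp only [h₁, Category.assoc, ht, hf'π]
    rw [reassoc_of% (hdπ n (n + 1))]
    simp
  have hf : f = Homotopy.nullHomotopicMap' h₀ + Homotopy.nullHomotopicMap' h₁ := by
    rw [← hf']; simp [f']
  rw [hf]
  exact ⟨((Homotopy.nullHomotopy' h₀).add (Homotopy.nullHomotopy' h₁)).trans
    (Homotopy.ofEq (by simp))⟩

end htpy

theorem small_of_nontrivial (k A : Type u) [Field k] [CommRing A] [Algebra k A]
    [Algebra.FiniteType k A] (M : Type v) [AddCommGroup M] [Module A M] [Nontrivial M] :
    Small.{v} A := by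
  obtain ⟨m, hm⟩ := exists_ne (0 : M)
  let : Module k M := Module.compHom M (algebraMap k A)
  have : Small.{v} k := small_of_injective (f := fun c : k ↦ c • m) (smul_left_injective k hm)
  exact Algebra.FiniteType.small (R := k)

theorem exactAt_shift {C : Type*} [Category* C] [Abelian C] (L : CochainComplex C ℤ)
    (hL : ∀ n, L.ExactAt n) (n m : ℤ) : (L⟦n⟧).ExactAt m := by
  rw [HomologicalComplex.exactAt_iff_isZero_homology]
  exact ((HomologicalComplex.exactAt_iff_isZero_homology _ _).mp (hL (n + m))).of_iso
    ((CochainComplex.ShiftSequence.shiftIso C n m (n + m) rfl).app L)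

/-- Paper's Lemma 1.6: a (possibly unbounded) complex of projective modules is
K-projective, i.e. any chain map from it to a shifted acyclic complex is
nullhomotopic. -/
theorem stmt_2 {k A : Type u} [Field k] [IsAlgClosed k] [CharZero k]
    [CommRing A] [IsDomain A] [Algebra k A]
    [Algebra.FormallySmooth k A] [Algebra.FinitePresentation k A]
    (hdim : ringKrullDim A = 1)
    (F₀ F₁ : CochainComplex (ModuleCat.{v} A) ℤ)
    (hF₀ : ∀ n : ℤ, Projective (F₀.X n))
    (hF₁ : ∀ n : ℤ, F₁.ExactAt n) :
    ∀ (n : ℤ) (f : F₀ ⟶ F₁⟦n⟧), Nonempty (Homotopy f 0) := by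
  intro n f
  by_cases hA : Small.{v} A
  · have : Algebra.Smooth k A := { }
    have := isDedekindDomain_of_smooth_curve k A hdim
    exact nonempty_homotopy_zero_of_hereditary (fun i _ _ ↦ projective_of_mono i) _ _ hF₀
      (exactAt_shift F₁ hF₁ n) f
  · have hf : f = 0 := by
      ext m x
      have : Subsingleton (F₀.X m) := by
        by_contra h
        rw [not_subsingleton_iff_nontrivial] at h
        exact hA (small_of_nontrivial k A (F₀.X m))
      rw [Subsingleton.elim x 0, map_zero, map_zero]
    exact ⟨Homotopy.ofEq hf⟩
end

section
/- Let H be a commutative ring and D : H → H a derivation (an additive map satisfying D(xy) = x·D(y) + D(x)·y). Then for every h ∈ H and every integer m ≥ 1, the m-th iterate satisfies D^[m](h^m) − m!·(D h)^m ∈ (h), the principal ideal generated by h. (The congruence (1.87) asserted in the proof of Proposition 1.21.) -/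
theorem stmt_4_aux {H : Type*} [CommRing H] (D : Derivation ℤ H H)
    (h : H) (m k : ℕ) : ∀ n : ℕ, n + k = m → ∃ c : H,
    (⇑D)^[k] (h ^ m) = (m.descFactorial k : H) * (h ^ n * (D h) ^ k) + h ^ (n + 1) * c := by
  induction k with
  | zero =>
    intro n hn
    refine ⟨0, ?_⟩
    have : n = m := by omega
    subst this
    simp
  | succ k ih =>
    intro n hn
    obtain ⟨c, hc⟩ := ih (n + 1) (by omega)
    have hmk : m - k = n + 1 := by omega
    refine ⟨(m.descFactorial k : H) * D ((D h) ^ k) + (n + 2) * D h * c + h * D c, ?_⟩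
    rw [Function.iterate_succ_apply', hc, Nat.descFactorial_succ, hmk]
    simp only [map_add, Derivation.leibniz, Derivation.map_natCast, smul_eq_mul,
      Derivation.leibniz_pow D h, nsmul_eq_mul, Nat.add_sub_cancel]
    push_cast
    ring

/-- The congruence (1.87) from the proof of Proposition 1.21: for a derivation `D`
of a commutative ring `H`, one has `D^[m] (h^m) ≡ m! * (D h)^m` modulo the
principal ideal `(h)`. -/
theorem stmt_4 {H : Type*} [CommRing H] (D : Derivation ℤ H H)
    (h : H) (m : ℕ) (hm : 1 ≤ m) :
    (⇑D)^[m] (h ^ m) - (m.factorial : H) * (D h) ^ m ∈ Ideal.span {h} := by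
  obtain ⟨c, hc⟩ := stmt_4_aux D h m m 0 (by omega)
  rw [hc, Ideal.mem_span_singleton, Nat.descFactorial_self]
  exact ⟨c, by ring⟩
end

section
/- Critical points of the Hori–Vafa superpotential (the claim following (5.36)): let r ≥ 1 and let z : Fin r → ℂ have all coordinates nonzero. Then the derivative of W vanishes at z (fderiv ℂ W z = 0) if and only if there exists λ ∈ ℂ with λ^(r−1) = −1 and z i = λ for all i. In particular W has exactly r − 1 critical points on (ℂ*)^r, all lying on the diagonal. -/
/-- The Hori–Vafa superpotential `W(z) = z₁ + ⋯ + z_r + z₁⋯z_r` (5.36). -/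
noncomputable def horiVafa (r : ℕ) (z : Fin r → ℂ) : ℂ := (∑ i, z i) + ∏ i, z i

/-- Critical points of the Hori–Vafa superpotential: a point with nonzero
coordinates is critical iff it is the constant point `(λ,…,λ)` for some
`λ` with `λ^(r-1) = -1`. -/
theorem stmt_12 (r : ℕ) (hr : 1 ≤ r) (z : Fin r → ℂ) (hz : ∀ i, z i ≠ 0) :
    fderiv ℂ (horiVafa r) z = 0 ↔
      ∃ l : ℂ, l ^ (r - 1) = -1 ∧ ∀ i, z i = l := by
  have hd : HasFDerivAt (horiVafa r)
      ((∑ i, ContinuousLinearMap.proj (R := ℂ) (φ := fun _ : Fin r => ℂ) i) +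
        ∑ i, (∏ j ∈ Finset.univ.erase i, z j) •
          ContinuousLinearMap.proj (R := ℂ) (φ := fun _ : Fin r => ℂ) i) z := by
    unfold horiVafa
    refine HasFDerivAt.add ?_ ?_
    · exact HasFDerivAt.fun_sum fun i _ => hasFDerivAt_apply i z
    · exact HasFDerivAt.finsetProd fun i _ => hasFDerivAt_apply i z
  have key : fderiv ℂ (horiVafa r) z = 0 ↔
      ∀ i, 1 + ∏ j ∈ Finset.univ.erase i, z j = 0 := by
    rw [hd.fderiv]
    constructor
    · intro h i
      have h1 := congrArg (fun L => L (Pi.single i 1)) h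
      simpa [ContinuousLinearMap.sum_apply, Pi.single_apply] using h1
    · intro h
      ext v
      simp only [ContinuousLinearMap.add_apply, ContinuousLinearMap.sum_apply,
        ContinuousLinearMap.smul_apply, ContinuousLinearMap.proj_apply, smul_eq_mul,
        ContinuousLinearMap.zero_apply]
      rw [← Finset.sum_add_distrib]
      refine Finset.sum_eq_zero fun i _ => ?_
      linear_combination (v i) * h i
  rw [key]
  constructor
  · intro h
    have hP : ∀ i, z i = - ∏ j, z j := by
      intro i
      rw [← Finset.mul_prod_erase Finset.univ z (Finset.mem_univ i)]
      linear_combination (z i) * h i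
    refine ⟨- ∏ j, z j, ?_, hP⟩
    have h0 := h ⟨0, hr⟩
    rw [Finset.prod_congr rfl (fun j _ => hP j), Finset.prod_const,
      Finset.card_erase_of_mem (Finset.mem_univ _), Finset.card_univ, Fintype.card_fin] at h0
    linear_combination h0
  · rintro ⟨l, hl, hzl⟩ i
    rw [Finset.prod_congr rfl (fun j _ => hzl j), Finset.prod_const,
      Finset.card_erase_of_mem (Finset.mem_univ _), Finset.card_univ, Fintype.card_fin, hl]
    ring
end

section
/- Nondegeneracy of the critical points of the Hori–Vafa superpotential (the claim following (5.36)): let r ≥ 2 and λ ∈ ℂ with λ^(r−1) = −1, and let c : Fin r → ℂ be the constant function with value λ. Then the Hessian matrix H : Matrix (Fin r) (Fin r) ℂ of W at c, with entries H i j = fderiv ℂ (fun z => fderiv ℂ W z (Pi.single j 1)) c (Pi.single i 1), is invertible (its determinant is nonzero). -/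
lemma hv_fderiv (r : ℕ) (j : Fin r) (z : Fin r → ℂ) :
    fderiv ℂ (horiVafa r) z (Pi.single j 1) = 1 + ∏ k ∈ Finset.univ.erase j, z k := by
  have hp : ∀ k ∈ (Finset.univ : Finset (Fin r)), HasFDerivAt (fun z : Fin r → ℂ => z k)
      (ContinuousLinearMap.proj (R := ℂ) (φ := fun _ : Fin r => ℂ) k) z :=
    fun k _ => hasFDerivAt_apply k z
  have h := (HasFDerivAt.fun_sum hp).add (HasFDerivAt.finsetProd hp)
  have h2 : HasFDerivAt (horiVafa r) _ z := h
  rw [h2.fderiv]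
  simp [Pi.single_apply]

lemma hv_hess (r : ℕ) (i j : Fin r) (lam : ℂ) :
    fderiv ℂ (fun z => fderiv ℂ (horiVafa r) z (Pi.single j 1))
          (fun _ => lam) (Pi.single i 1) = if i = j then 0 else lam ^ (r - 2) := by
  simp only [hv_fderiv]
  have hp : ∀ k ∈ (Finset.univ.erase j : Finset (Fin r)), HasFDerivAt (fun z : Fin r → ℂ => z k)
      (ContinuousLinearMap.proj (R := ℂ) (φ := fun _ : Fin r => ℂ) k) (fun _ => lam) :=
    fun k _ => hasFDerivAt_apply k _
  rw [((HasFDerivAt.finsetProd hp).const_add 1).fderiv]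
  simp only [ContinuousLinearMap.sum_apply, ContinuousLinearMap.smul_apply,
    ContinuousLinearMap.proj_apply, Pi.single_apply, smul_eq_mul, mul_ite, mul_one, mul_zero,
    Finset.sum_ite_eq', Finset.prod_const, Finset.mem_erase, Finset.mem_univ, and_true]
  by_cases h : i = j
  · simp [h]
  · have h3 : ((Finset.univ.erase j).erase i : Finset (Fin r)).card = r - 2 := by
      rw [Finset.card_erase_of_mem (by simp [h]), Finset.card_erase_of_mem (by simp)]
      simp
      omega
    simp [h, h3]

/-- Nondegeneracy of the critical points of the Hori–Vafa superpotential: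
the Hessian matrix at a critical point `(λ,…,λ)`, `λ^(r-1) = -1`, has nonzero
determinant. -/
theorem stmt_13 (r : ℕ) (hr : 2 ≤ r) (lam : ℂ) (hlam : lam ^ (r - 1) = -1) :
    (Matrix.of fun i j : Fin r =>
        fderiv ℂ (fun z => fderiv ℂ (horiVafa r) z (Pi.single j 1))
          (fun _ => lam) (Pi.single i 1)).det ≠ 0 := by
  simp only [hv_hess]
  have hl : lam ≠ 0 := by
    rintro rfl
    rw [zero_pow (by omega)] at hlam
    norm_num at hlam
  intro hdet
  obtain ⟨v, hv, hv0⟩ := Matrix.exists_mulVec_eq_zero_iff.mpr hdet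
  apply hv
  have key : ∀ i, v i = ∑ j, v j := by
    intro i
    have h := congrFun hv0 i
    simp only [Matrix.mulVec, dotProduct, Matrix.of_apply, Pi.zero_apply] at h
    have h2 : ∑ j, (if i = j then 0 else lam ^ (r - 2)) * v j
        = lam ^ (r - 2) * (∑ j, v j - v i) := by
      have : ∀ j, (if i = j then 0 else lam ^ (r - 2)) * v j
          = lam ^ (r - 2) * v j - (if i = j then lam ^ (r - 2) * v j else 0) := by
        intro j
        split_ifs <;> ring
      simp only [this, Finset.sum_sub_distrib, Finset.sum_ite_eq, Finset.mem_univ, if_true,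
        ← Finset.mul_sum]
      ring
    rw [h2] at h
    have h3 := (mul_eq_zero.mp h).resolve_left (pow_ne_zero _ hl)
    exact (sub_eq_zero.mp h3).symm
  have hs : ∑ j, v j = r * ∑ j, v j := by
    conv_lhs => rw [Finset.sum_congr rfl (fun i _ => key i)]
    simp
  have hr1 : ((r : ℂ) - 1) ≠ 0 := by
    rw [sub_ne_zero]
    exact_mod_cast (by omega : r ≠ 1)
  have hz : ∑ j, v j = 0 := by
    have : ((r : ℂ) - 1) * ∑ j, v j = 0 := by linear_combination -hs
    exact (mul_eq_zero.mp this).resolve_left hr1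
  funext i
  rw [key i, hz]
  rfl
end

section
/- Diagonalization of the Clifford quadratic form (the paper's claim (5.39) in Addendum 5.7): let r ≥ 2 be an integer, λ ∈ ℂ, and s ∈ ℂ with s² = 1 − r. Define the quadratic form Q on Fin r → ℂ by Q(x) = −λ·((∑ i, x i)² − ∑ i, (x i)²), so that Q(eᵢ) = 0 for each standard basis vector eᵢ and the polar form satisfies polar Q eᵢ eⱼ = −2λ for i ≠ j. Set c = −1/r + 1/(r·s) and vᵢ = eᵢ + c·(e₁ + ⋯ + e_r), i.e., vᵢ j = c + (if j = i then 1 else 0). Then Q(vᵢ) = λ for every i, and polar Q vᵢ vⱼ = 0 for all i ≠ j. Consequently, in the Clifford algebra of Q the elements ι(vᵢ) square to λ and pairwise anticommute. -/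
/-- The diagonalization (5.39) of the Clifford quadratic form of Addendum 5.7:
the vectors `vᵢ = eᵢ + c·(e₁+⋯+e_r)` with `c = -1/r + 1/(r·s)`, `s² = 1-r`,
satisfy `Q(vᵢ) = λ` and pairwise vanishing polar form, so in the Clifford
algebra of `Q` the `ι(vᵢ)` square to `λ` and pairwise anticommute. -/
theorem stmt_14 (r : ℕ) (hr : 2 ≤ r) (lam s : ℂ) (hs : s ^ 2 = 1 - (r : ℂ))
    (Q : QuadraticForm ℂ (Fin r → ℂ))
    (hQ : ∀ x : Fin r → ℂ, Q x = -lam * ((∑ i, x i) ^ 2 - ∑ i, (x i) ^ 2))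
    (v : Fin r → Fin r → ℂ)
    (hv : ∀ i j : Fin r,
      v i j = (-1 / (r : ℂ) + 1 / ((r : ℂ) * s)) + (if j = i then 1 else 0)) :
    (∀ i, Q (v i) = lam) ∧
    (∀ i j, i ≠ j → QuadraticMap.polar (⇑Q) (v i) (v j) = 0) ∧
    (∀ i, CliffordAlgebra.ι Q (v i) * CliffordAlgebra.ι Q (v i)
      = algebraMap ℂ (CliffordAlgebra Q) lam) ∧
    (∀ i j, i ≠ j →
      CliffordAlgebra.ι Q (v i) * CliffordAlgebra.ι Q (v j)
        + CliffordAlgebra.ι Q (v j) * CliffordAlgebra.ι Q (v i) = 0) := by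
  have hr0 : (r : ℂ) ≠ 0 := by
    exact_mod_cast (by omega : r ≠ 0)
  have hs0 : s ≠ 0 := by
    rintro rfl
    have h1 : (r : ℂ) = 1 := by linear_combination hs
    have h2 : r = 1 := by exact_mod_cast h1
    omega
  obtain ⟨c, hc⟩ : ∃ c : ℂ, c = -1 / (r : ℂ) + 1 / ((r : ℂ) * s) := ⟨_, rfl⟩
  rw [← hc] at hv
  have key : ((r : ℂ) * c + 1) ^ 2 = r * c ^ 2 + 2 * c := by
    have h1 : s * (r * c + 1) = 1 := by
      rw [hc]; field_simp; ring
    have h2 : (1 - (r : ℂ)) * (r * c + 1) ^ 2 = 1 := by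
      rw [← hs, ← mul_pow, h1, one_pow]
    apply mul_left_cancel₀ hr0
    linear_combination -h2
  have hsum : ∀ i, ∑ j, v i j = r * c + 1 := by
    intro i
    simp [hv, Finset.sum_add_distrib]
  have hprod : ∀ i k, ∑ j, v i j * v k j = r * c ^ 2 + 2 * c + if k = i then 1 else 0 := by
    intro i k
    simp only [hv, add_mul, mul_add, Finset.sum_add_distrib]
    simp
    ring
  have hQv : ∀ i, Q (v i) = lam := by
    intro i
    have h := hprod i i
    simp only [← pow_two, if_true] at h
    rw [hQ, hsum, h, key]
    ring
  have hpol : ∀ i j, i ≠ j → QuadraticMap.polar (⇑Q) (v i) (v j) = 0 := by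
    intro i j hij
    have h := hprod i j
    rw [if_neg hij.symm] at h
    have e : ∑ k, (v i k + v j k) ^ 2
        = ∑ k, v i k ^ 2 + 2 * ∑ k, v i k * v j k + ∑ k, v j k ^ 2 := by
      rw [Finset.mul_sum, ← Finset.sum_add_distrib, ← Finset.sum_add_distrib]
      exact Finset.sum_congr rfl fun k _ => by ring
    simp only [QuadraticMap.polar, hQ, Pi.add_apply]
    rw [e, Finset.sum_add_distrib, hsum, hsum, h]
    linear_combination (-2 * lam) * key
  refine ⟨hQv, hpol, fun i => ?_, fun i j hij => ?_⟩
  · rw [CliffordAlgebra.ι_sq_scalar, hQv]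
  · rw [CliffordAlgebra.ι_mul_ι_add_swap, hpol i j hij, map_zero]
end
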